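/- arXiv:2403.03023 — 11 statements merged into one kernel-verified Lean document; each statement's English description precedes it below -/
import Mathlib

section
/- Let U ⊆ ℂ be open, α ∈ ℂ, and let q, p : ℂ → ℂ be holomorphic on U, with p nonvanishing on U, satisfying the Hamiltonian system q′(z) = p(z) − q(z)² − z/2 and p′(z) = 2p(z)q(z) + α + 1/2 on U. Then p satisfies the thirty-fourth Painlevé equation with parameter α on U: p″(z) = ((p′(z))² − (α + 1/2)²)/(2p(z)) + 2p(z)² − z·p(z). -/
/-- If holomorphic `q, p` on an open set `U ⊆ ℂ`, with `p` nonvanishing, satisfy the Hamiltonian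
system for P_II with parameter `α`, then `p` satisfies the thirty-fourth Painlevé equation with
parameter `α` on `U`. -/
theorem hamiltonian_system_p_solves_painleveXXXIV (U : Set ℂ) (hU : IsOpen U) (α : ℂ)
    (q p : ℂ → ℂ) (hq : DifferentiableOn ℂ q U) (hp : DifferentiableOn ℂ p U)
    (hp0 : ∀ z ∈ U, p z ≠ 0)
    (h1 : ∀ z ∈ U, deriv q z = p z - q z ^ 2 - z / 2)
    (h2 : ∀ z ∈ U, deriv p z = 2 * p z * q z + α + 1 / 2) :
    ∀ z ∈ U, deriv (deriv p) z =
      ((deriv p z) ^ 2 - (α + 1 / 2) ^ 2) / (2 * p z) + 2 * p z ^ 2 - z * p z := by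
  intro z hz
  have hUz : U ∈ nhds z := hU.mem_nhds hz
  have hqz := (hq.differentiableAt hUz).hasDerivAt
  have hpz := (hp.differentiableAt hUz).hasDerivAt
  have hloc : deriv p =ᶠ[nhds z] fun w => 2 * p w * q w + α + 1 / 2 := by
    filter_upwards [hUz] with w hw using h2 w hw
  have hderiv := (((hpz.const_mul 2).fun_mul hqz).add_const α).add_const (1 / 2)
  rw [hloc.deriv_eq, HasDerivAt.deriv hderiv, h1 z hz, h2 z hz]
  have hpne := hp0 z hz
  field_simp
  ring
end

section
/- Let U ⊆ ℂ be open, α ∈ ℂ, and let q, p : ℂ → ℂ be holomorphic on U and satisfy the Hamiltonian system q′(z) = p(z) − q(z)² − z/2 and p′(z) = 2p(z)q(z) + α + 1/2 on U. Define σ(z) := p(z)²/2 − (q(z)² + z/2)·p(z) − (α + 1/2)·q(z). Then σ satisfies the Jimbo–Miwa–Okamoto σ-form of P_II with parameter α on U: (σ″(z))² + 4(σ′(z))³ + 2σ′(z)·(z·σ′(z) − σ(z)) = (α/2 + 1/4)². -/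
/-- If holomorphic `q, p` on an open set `U ⊆ ℂ` satisfy the Hamiltonian system for P_II with
parameter `α`, then `σ := H_II(q, p, z; α)` satisfies the Jimbo–Miwa–Okamoto σ-form of P_II. -/
theorem hamiltonian_solves_sigma_form (U : Set ℂ) (hU : IsOpen U) (α : ℂ)
    (q p : ℂ → ℂ) (hq : DifferentiableOn ℂ q U) (hp : DifferentiableOn ℂ p U)
    (h1 : ∀ z ∈ U, deriv q z = p z - q z ^ 2 - z / 2)
    (h2 : ∀ z ∈ U, deriv p z = 2 * p z * q z + α + 1 / 2)
    (σ : ℂ → ℂ)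
    (hσ : ∀ z, σ z = p z ^ 2 / 2 - (q z ^ 2 + z / 2) * p z - (α + 1 / 2) * q z) :
    ∀ z ∈ U, (deriv (deriv σ) z) ^ 2 + 4 * (deriv σ z) ^ 3
        + 2 * deriv σ z * (z * deriv σ z - σ z) = (α / 2 + 1 / 4) ^ 2 := by
  have hσ' : ∀ z ∈ U, deriv σ z = -p z / 2 := by
    intro z hz
    have hdq := (hq.differentiableAt (hU.mem_nhds hz)).hasDerivAt
    have hdp := (hp.differentiableAt (hU.mem_nhds hz)).hasDerivAt
    rw [h1 z hz] at hdq
    rw [h2 z hz] at hdp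
    have hd := (((hdp.pow 2).div_const 2).sub
      (((hdq.pow 2).add ((hasDerivAt_id z).div_const 2)).mul hdp)).sub
      (hdq.const_mul (α + 1 / 2))
    rw [show σ = _ from funext hσ]
    refine HasDerivAt.deriv (hd.congr_deriv ?_)
    simp
    ring
  intro z hz
  have hσ'' : deriv (deriv σ) z = -(2 * p z * q z + α + 1 / 2) / 2 := by
    have hev : deriv σ =ᶠ[nhds z] fun w => -p w / 2 := by
      filter_upwards [hU.mem_nhds hz] with w hw using hσ' w hw
    have hdp := (hp.differentiableAt (hU.mem_nhds hz)).hasDerivAt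
    rw [h2 z hz] at hdp
    rw [hev.deriv_eq]
    exact (hdp.neg.div_const 2).deriv
  rw [hσ'', hσ' z hz, hσ z]
  ring
end

section
/- Let U ⊆ ℂ be open, α ∈ ℂ, and let q, p : ℂ → ℂ be holomorphic on U and satisfy the Hamiltonian system q′(z) = p(z) − q(z)² − z/2 and p′(z) = 2p(z)q(z) + α + 1/2 on U. Define p̂(z) := p(z) − 2q(z)² − z. Then the pair (q, p̂) satisfies the modified Hamiltonian system q′(z) = p̂(z) + q(z)² + z/2 and p̂′(z) = −2p̂(z)·q(z) + α − 1/2 on U. -/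
/-- If holomorphic `q, p` on an open set `U ⊆ ℂ` satisfy the Hamiltonian system for P_II with
parameter `α`, then the pair `(q, p̂)` with `p̂ := p − 2q² − z` satisfies the modified
Hamiltonian system `q′ = p̂ + q² + z/2`, `p̂′ = −2 p̂ q + α − 1/2` on `U`. -/
theorem modified_hamiltonian_system (U : Set ℂ) (hU : IsOpen U) (α : ℂ)
    (q p : ℂ → ℂ) (hq : DifferentiableOn ℂ q U) (hp : DifferentiableOn ℂ p U)
    (h1 : ∀ z ∈ U, deriv q z = p z - q z ^ 2 - z / 2)
    (h2 : ∀ z ∈ U, deriv p z = 2 * p z * q z + α + 1 / 2)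
    (phat : ℂ → ℂ) (hphat : ∀ z, phat z = p z - 2 * q z ^ 2 - z) :
    (∀ z ∈ U, deriv q z = phat z + q z ^ 2 + z / 2) ∧
      (∀ z ∈ U, deriv phat z = -2 * phat z * q z + α - 1 / 2) := by
  refine ⟨fun z hz => by rw [h1 z hz, hphat z]; ring, fun z hz => ?_⟩
  have hq' : HasDerivAt q (deriv q z) z := (hq.differentiableAt (hU.mem_nhds hz)).hasDerivAt
  have hp' : HasDerivAt p (deriv p z) z := (hp.differentiableAt (hU.mem_nhds hz)).hasDerivAt
  have hder : HasDerivAt (fun w => p w - 2 * q w ^ 2 - w) _ z :=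
    (hp'.sub ((hq'.pow 2).const_mul 2)).sub (hasDerivAt_id z)
  rw [funext hphat, hder.deriv, h1 z hz, h2 z hz]
  push_cast
  ring
end

section
/- Let U ⊆ ℂ be open, n ∈ ℂ, and let q : ℂ → ℂ be holomorphic on U satisfying the second Painlevé equation with parameter α = n − 1/2 on U, i.e. q″(z) = 2q(z)³ + z·q(z) + n − 1/2, and suppose 2q(z)² + 2q′(z) + z ≠ 0 for all z ∈ U. Then the Bäcklund transform q₊(z) := −q(z) − 2n/(2q(z)² + 2q′(z) + z) satisfies the second Painlevé equation with parameter α = n + 1/2 on U: q₊″(z) = 2q₊(z)³ + z·q₊(z) + n + 1/2. -/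
/-- Bäcklund transformation: if `q` is holomorphic on an open set `U ⊆ ℂ`, solves P_II with
parameter `α = n − 1/2`, and `2q² + 2q′ + z ≠ 0` on `U`, then
`q₊ := −q − 2n/(2q² + 2q′ + z)` solves P_II with parameter `α = n + 1/2` on `U`. -/
theorem backlund_forward (U : Set ℂ) (hU : IsOpen U) (n : ℂ)
    (q : ℂ → ℂ) (hq : DifferentiableOn ℂ q U)
    (hP2 : ∀ z ∈ U, deriv (deriv q) z = 2 * q z ^ 3 + z * q z + (n - 1 / 2))
    (hden : ∀ z ∈ U, 2 * q z ^ 2 + 2 * deriv q z + z ≠ 0)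
    (qplus : ℂ → ℂ)
    (hqp : ∀ z, qplus z = -q z - 2 * n / (2 * q z ^ 2 + 2 * deriv q z + z)) :
    ∀ z ∈ U, deriv (deriv qplus) z = 2 * qplus z ^ 3 + z * qplus z + (n + 1 / 2) := by
  have hdq : ∀ z ∈ U, HasDerivAt q (deriv q z) z := fun z hz =>
    (hq.differentiableAt (hU.mem_nhds hz)).hasDerivAt
  have hddq : ∀ z ∈ U, HasDerivAt (deriv q) (2 * q z ^ 3 + z * q z + (n - 1 / 2)) z := by
    intro z hz
    rw [← hP2 z hz]
    exact ((hq.deriv hU).differentiableAt (hU.mem_nhds hz)).hasDerivAt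
  -- The denominator `f` satisfies the Riccati-type equation `f' = 2 q f + 2 n`.
  have hf : ∀ z ∈ U, HasDerivAt (fun w => 2 * q w ^ 2 + 2 * deriv q w + w)
      (2 * q z * (2 * q z ^ 2 + 2 * deriv q z + z) + 2 * n) z := by
    intro z hz
    refine ((((hdq z hz).pow 2).const_mul 2).add ((hddq z hz).const_mul 2)).add
      (hasDerivAt_id z) |>.congr_deriv ?_
    push_cast
    ring
  have hqplus : qplus = fun z => -q z - 2 * n / (2 * q z ^ 2 + 2 * deriv q z + z) :=
    funext hqp
  -- Equivalently, `q₊' - q₊² = (z - f) / 2`.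
  have hd : ∀ z ∈ U, HasDerivAt qplus
      (qplus z ^ 2 - (2 * q z ^ 2 + 2 * deriv q z + z) / 2 + z / 2) z := by
    intro z hz
    have hne := hden z hz
    have h := (hdq z hz).neg.sub ((hasDerivAt_const z (2 * n)).div (hf z hz) hne)
    rw [hqp z, hqplus]
    refine h.congr_deriv ?_
    generalize hF : 2 * q z ^ 2 + 2 * deriv q z + z = F at hne ⊢
    have hq' : deriv q z = (F - z) / 2 - q z ^ 2 := by rw [← hF]; ring
    rw [hq']
    field_simp
    ring
  intro z hz
  have hev : deriv qplus =ᶠ[nhds z]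
      fun w => qplus w ^ 2 - (2 * q w ^ 2 + 2 * deriv q w + w) / 2 + w / 2 := by
    filter_upwards [hU.mem_nhds hz] with w hw using (hd w hw).deriv
  have h := (((hd z hz).pow 2).sub ((hf z hz).div_const 2)).add
    ((hasDerivAt_id z).div_const 2)
  refine (hev.deriv_eq.trans h.deriv).trans ?_
  have hmul : (qplus z + q z) * (2 * q z ^ 2 + 2 * deriv q z + z) = -(2 * n) := by
    have hne := hden z hz
    rw [hqp z]
    generalize 2 * q z ^ 2 + 2 * deriv q z + z = F at hne ⊢
    field_simp
    ring
  push_cast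
  linear_combination -hmul
end

section
/- Let U ⊆ ℂ be open, n ∈ ℂ, and let q : ℂ → ℂ be holomorphic on U satisfying the second Painlevé equation with parameter α = n − 1/2 on U, i.e. q″(z) = 2q(z)³ + z·q(z) + n − 1/2, and suppose 2q′(z) − 2q(z)² − z ≠ 0 for all z ∈ U. Then the inverse Bäcklund transform q₋(z) := −q(z) + 2(n − 1)/(2q′(z) − 2q(z)² − z) satisfies the second Painlevé equation with parameter α = n − 3/2 on U: q₋″(z) = 2q₋(z)³ + z·q₋(z) + n − 3/2. -/
/-- Inverse Bäcklund transformation: if `q` is holomorphic on an open set `U ⊆ ℂ`, solves P_II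
with parameter `α = n − 1/2`, and `2q′ − 2q² − z ≠ 0` on `U`, then
`q₋ := −q + 2(n − 1)/(2q′ − 2q² − z)` solves P_II with parameter `α = n − 3/2` on `U`. -/
theorem backlund_inverse (U : Set ℂ) (hU : IsOpen U) (n : ℂ)
    (q : ℂ → ℂ) (hq : DifferentiableOn ℂ q U)
    (hP2 : ∀ z ∈ U, deriv (deriv q) z = 2 * q z ^ 3 + z * q z + (n - 1 / 2))
    (hden : ∀ z ∈ U, 2 * deriv q z - 2 * q z ^ 2 - z ≠ 0)
    (qminus : ℂ → ℂ)
    (hqm : ∀ z, qminus z = -q z + 2 * (n - 1) / (2 * deriv q z - 2 * q z ^ 2 - z)) :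
    ∀ z ∈ U, deriv (deriv qminus) z = 2 * qminus z ^ 3 + z * qminus z + (n - 3 / 2) := by
  have hq1 : ∀ z ∈ U, HasDerivAt q (deriv q z) z := fun z hz =>
    (hq.differentiableAt (hU.mem_nhds hz)).hasDerivAt
  have hq2 : ∀ z ∈ U, HasDerivAt (deriv q) (2 * q z ^ 3 + z * q z + (n - 1 / 2)) z := by
    intro z hz
    rw [← hP2 z hz]
    exact ((hq.deriv hU).differentiableAt (hU.mem_nhds hz)).hasDerivAt
  obtain ⟨w, hw⟩ : ∃ w : ℂ → ℂ,
      w = fun z => 2 * (n - 1) / (2 * deriv q z - 2 * q z ^ 2 - z) := ⟨_, rfl⟩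
  have hw_mul : ∀ z ∈ U, w z * (2 * deriv q z - 2 * q z ^ 2 - z) = 2 * (n - 1) := by
    intro z hz
    rw [hw]
    exact div_mul_cancel₀ _ (hden z hz)
  -- The correction term solves a Riccati equation.
  have hw1 : ∀ z ∈ U, HasDerivAt w (2 * q z * w z - w z ^ 2) z := by
    intro z hz
    have hD := (((hq2 z hz).const_mul 2).sub (((hq1 z hz).pow 2).const_mul 2)).sub
      (hasDerivAt_id z)
    have h := (hasDerivAt_const z (2 * (n - 1))).div hD (hden z hz)
    have hd := hden z hz
    rw [hw]
    refine h.congr_deriv ?_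
    simp only [Pi.sub_apply, Pi.pow_apply, id_eq]
    field_simp
    push_cast
    ring
  have hqw : qminus = fun z => -q z + w z := by
    funext z
    rw [hqm, hw]
  have hm1 : ∀ z ∈ U, deriv qminus z = -deriv q z + (2 * q z * w z - w z ^ 2) := by
    intro z hz
    rw [hqw]
    exact ((hq1 z hz).neg.add (hw1 z hz)).deriv
  intro z hz
  have hm2 := (hq2 z hz).neg.add
    ((((hq1 z hz).const_mul 2).mul (hw1 z hz)).sub ((hw1 z hz).pow 2))
  rw [(Filter.eventuallyEq_of_mem (hU.mem_nhds hz) hm1).deriv_eq]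
  refine hm2.deriv.trans ?_
  rw [hqw]
  push_cast
  linear_combination hw_mul z hz
end

section
/- Let U ⊆ ℂ be open, n ∈ ℂ, and let q : ℂ → ℂ be holomorphic on U satisfying the second Painlevé equation with parameter α = n − 1/2 on U, with 2q′(z) − 2q(z)² − z ≠ 0 for all z ∈ U. Define p(z) := q′(z) + q(z)² + z/2, the inverse Bäcklund transform q₋(z) := −q(z) + 2(n − 1)/(2q′(z) − 2q(z)² − z), and p₋(z) := q₋′(z) + q₋(z)² + z/2. Then p₋(z) = −p(z) + 2q(z)² + z for all z ∈ U. -/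
/-- If `q` is holomorphic on an open set `U ⊆ ℂ`, solves P_II with parameter `α = n − 1/2`,
and `2q′ − 2q² − z ≠ 0` on `U`, then the momentum `p₋` associated to the inverse Bäcklund
transform `q₋` satisfies `p₋ = −p + 2q² + z` on `U`. -/
theorem backlund_momentum_identity (U : Set ℂ) (hU : IsOpen U) (n : ℂ)
    (q : ℂ → ℂ) (hq : DifferentiableOn ℂ q U)
    (hP2 : ∀ z ∈ U, deriv (deriv q) z = 2 * q z ^ 3 + z * q z + (n - 1 / 2))
    (hden : ∀ z ∈ U, 2 * deriv q z - 2 * q z ^ 2 - z ≠ 0)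
    (p qminus pminus : ℂ → ℂ)
    (hp : ∀ z, p z = deriv q z + q z ^ 2 + z / 2)
    (hqm : ∀ z, qminus z = -q z + 2 * (n - 1) / (2 * deriv q z - 2 * q z ^ 2 - z))
    (hpm : ∀ z, pminus z = deriv qminus z + qminus z ^ 2 + z / 2) :
    ∀ z ∈ U, pminus z = -p z + 2 * q z ^ 2 + z := by
  intro z hz
  have hzU : U ∈ nhds z := hU.mem_nhds hz
  have hq1 : HasDerivAt q (deriv q z) z := (hq.differentiableAt hzU).hasDerivAt
  have hq2 : HasDerivAt (deriv q) (deriv (deriv q) z) z :=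
    ((hq.deriv hU).differentiableAt hzU).hasDerivAt
  have hD := hden z hz
  have hdenom := ((hq2.const_mul 2).sub ((hq1.pow 2).const_mul 2)).sub (hasDerivAt_id z)
  have hqm' : HasDerivAt qminus _ z :=
    (hq1.neg.add ((hasDerivAt_const z (2 * (n - 1))).div hdenom hD)).congr_of_eventuallyEq
      (Filter.Eventually.of_forall hqm)
  rw [hpm, hp, hqm'.deriv, hqm, hP2 z hz]
  simp only [Pi.sub_apply, Pi.pow_apply, id]
  have hd : deriv q z = ((2 * deriv q z - 2 * q z ^ 2 - z) + 2 * q z ^ 2 + z) / 2 := by ring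
  generalize 2 * deriv q z - 2 * q z ^ 2 - z = D at hD hd ⊢
  rw [hd]
  field_simp
  push_cast
  ring
end

section
/- Let U ⊆ ℂ be open, n ∈ ℂ, and let q : ℂ → ℂ be holomorphic on U satisfying the second Painlevé equation with parameter α = n − 1/2 on U, with 2q′(z) − 2q(z)² − z ≠ 0 for all z ∈ U. Define p(z) := q′(z) + q(z)² + z/2, q₋(z) := −q(z) + 2(n − 1)/(2q′(z) − 2q(z)² − z), and p₋(z) := q₋′(z) + q₋(z)² + z/2. Then the P_II Hamiltonian with parameter n − 3/2 is invariant under this transformation: p₋(z)²/2 − (q₋(z)² + z/2)·p₋(z) − (n − 1)·q₋(z) = p(z)²/2 − (q(z)² + z/2)·p(z) − (n − 1)·q(z) for all z ∈ U. -/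
/-- Along a solution of P_II with parameter `n - 1/2`, the denominator
`D = 2q′ - 2q² - z` satisfies the Riccati-type equation `D′ = -2qD + 2(n - 1)`. -/
theorem hasDerivAt_painleveII_denominator {q : ℂ → ℂ} {z n : ℂ}
    (hq : DifferentiableAt ℂ q z) (hq' : DifferentiableAt ℂ (deriv q) z)
    (h : deriv (deriv q) z = 2 * q z ^ 3 + z * q z + (n - 1 / 2)) :
    HasDerivAt (fun w => 2 * deriv q w - 2 * q w ^ 2 - w)
      (-2 * q z * (2 * deriv q z - 2 * q z ^ 2 - z) + 2 * (n - 1)) z := by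
  refine (((hq'.hasDerivAt.const_mul 2).sub ((hq.hasDerivAt.pow 2).const_mul 2)).sub
    (hasDerivAt_id z)).congr_deriv ?_
  rw [h]
  push_cast
  ring

/-- Invariance of the P_II Hamiltonian with parameter `n − 3/2` under the inverse Bäcklund
transformation. -/
theorem backlund_hamiltonian_invariance (U : Set ℂ) (hU : IsOpen U) (n : ℂ)
    (q : ℂ → ℂ) (hq : DifferentiableOn ℂ q U)
    (hP2 : ∀ z ∈ U, deriv (deriv q) z = 2 * q z ^ 3 + z * q z + (n - 1 / 2))
    (hden : ∀ z ∈ U, 2 * deriv q z - 2 * q z ^ 2 - z ≠ 0)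
    (p qminus pminus : ℂ → ℂ)
    (hp : ∀ z, p z = deriv q z + q z ^ 2 + z / 2)
    (hqm : ∀ z, qminus z = -q z + 2 * (n - 1) / (2 * deriv q z - 2 * q z ^ 2 - z))
    (hpm : ∀ z, pminus z = deriv qminus z + qminus z ^ 2 + z / 2) :
    ∀ z ∈ U,
      pminus z ^ 2 / 2 - (qminus z ^ 2 + z / 2) * pminus z - (n - 1) * qminus z
        = p z ^ 2 / 2 - (q z ^ 2 + z / 2) * p z - (n - 1) * q z := by
  intro z hz
  have hqz : DifferentiableAt ℂ q z := hq.differentiableAt (hU.mem_nhds hz)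
  have hq'z : DifferentiableAt ℂ (deriv q) z :=
    (hq.deriv hU).differentiableAt (hU.mem_nhds hz)
  have hD := hden z hz
  have hderiv := (hqz.hasDerivAt.neg.add ((hasDerivAt_const z (2 * (n - 1))).div
    (hasDerivAt_painleveII_denominator hqz hq'z (hP2 z hz)) hD)).deriv
  have hqm_eq : qminus = -q + (fun _ => 2 * (n - 1)) /
      (fun w => 2 * deriv q w - 2 * q w ^ 2 - w) := funext hqm
  rw [← hqm_eq] at hderiv
  have hpz : pminus z = -(2 * deriv q z - 2 * q z ^ 2 - z) / 2 := by
    rw [hpm, hderiv, hqm]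
    generalize hDz : 2 * deriv q z - 2 * q z ^ 2 - z = D at hD ⊢
    field_simp
    linear_combination (-D ^ 2) * hDz
  rw [hpz, hqm, hp]
  generalize hDz : 2 * deriv q z - 2 * q z ^ 2 - z = D at hD ⊢
  have hq' : deriv q z = D / 2 + q z ^ 2 + z / 2 := by linear_combination hDz / 2
  rw [hq']
  field_simp
  ring
end

section
/- Let f : ℂ → ℂ be entire, and for each n ≥ 1 define the Hankel determinant of derivatives H_n(z) := det[ f^{(j+k)}(z) ]_{j,k=0}^{n−1} (an n×n determinant whose (j,k) entry is the (j+k)-th derivative of f at z), with the convention H_0(z) := 1. Then for every n ≥ 1 and every z ∈ ℂ the Toda equation holds with constant 1: H_n(z)·H_n″(z) − (H_n′(z))² = H_{n+1}(z)·H_{n−1}(z). -/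
/-- The `n × n` Hankel determinant of derivatives of an entire function `f`:
`H_n(z) = det[ f^{(j+k)}(z) ]_{j,k=0}^{n−1}`; for `n = 0` this is the empty determinant,
which equals `1`. -/
noncomputable def hankelDerivDet (f : ℂ → ℂ) (n : ℕ) (z : ℂ) : ℂ :=
  (Matrix.of fun j k : Fin n => iteratedDeriv (j.1 + k.1) f z).det

namespace Matrix

/-- Jacobi's identity for complementary minors of the adjugate, multiplied by `det M`. -/
theorem det_toBlocks₂₂_adjugate_mul_det {m k R : Type*} [Fintype m] [Fintype k] [DecidableEq m]
    [DecidableEq k] [CommRing R] (M : Matrix (m ⊕ k) (m ⊕ k) R) :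
    M.adjugate.toBlocks₂₂.det * M.det = M.det ^ Fintype.card k * M.toBlocks₁₁.det := by
  have hmul : fromBlocks 1 0 M.adjugate.toBlocks₂₁ M.adjugate.toBlocks₂₂ * M
      = fromBlocks M.toBlocks₁₁ M.toBlocks₁₂ 0 (M.det • (1 : Matrix k k R)) := by
    have hadj := adjugate_mul M
    generalize M.det = d, M.adjugate = N at hadj
    rw [← fromBlocks_toBlocks N, ← fromBlocks_toBlocks M, fromBlocks_multiply, ← fromBlocks_one,
      fromBlocks_smul, fromBlocks_inj] at hadj
    conv_lhs => rw [← fromBlocks_toBlocks M]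
    rw [fromBlocks_multiply, hadj.2.2.1, hadj.2.2.2]
    simp
  have hdet := congrArg det hmul
  rw [det_mul, det_fromBlocks_zero₁₂, det_fromBlocks_zero₂₁, det_smul, det_one, det_one] at hdet
  linear_combination hdet

/-- The Desnanot–Jacobi identity in block form. -/
theorem det_toBlocks₂₂_adjugate {m R : Type*} [Fintype m] [DecidableEq m] [CommRing R]
    (M : Matrix (m ⊕ Fin 2) (m ⊕ Fin 2) R) :
    M.adjugate.toBlocks₂₂.det = M.det * M.toBlocks₁₁.det := by
  let X := mvPolynomialX (m ⊕ Fin 2) (m ⊕ Fin 2) ℤ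
  have hX : X.adjugate.toBlocks₂₂.det = X.det * X.toBlocks₁₁.det := by
    apply mul_right_cancel₀ (det_mvPolynomialX_ne_zero (m ⊕ Fin 2) ℤ)
    refine (det_toBlocks₂₂_adjugate_mul_det X).trans ?_
    rw [Fintype.card_fin]
    ring
  let φ : MvPolynomial ((m ⊕ Fin 2) × (m ⊕ Fin 2)) ℤ →+* R :=
    MvPolynomial.eval₂Hom (Int.castRingHom R) fun p => M p.1 p.2
  have hφ : φ.mapMatrix X = M := by
    ext i j
    simp [φ, X]
  have h := congrArg φ hX
  rw [map_mul, RingHom.map_det, RingHom.map_det, RingHom.map_det, hφ] at h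
  have h₁ : φ.mapMatrix X.toBlocks₁₁ = M.toBlocks₁₁ := by
    rw [← hφ]; rfl
  have h₂ : φ.mapMatrix X.adjugate.toBlocks₂₂ = M.adjugate.toBlocks₂₂ := by
    rw [← hφ, ← RingHom.map_adjugate]; rfl
  rwa [h₁, h₂] at h

/-- The Desnanot–Jacobi identity for the last two rows and columns. -/
theorem det_mul_det_submatrix_castAdd {m : ℕ} {R : Type*} [CommRing R]
    (M : Matrix (Fin (m + 2)) (Fin (m + 2)) R) :
    M.det * (M.submatrix (Fin.castAdd 2) (Fin.castAdd 2)).det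
      = (M.submatrix (Fin.last m).castSucc.succAbove (Fin.last m).castSucc.succAbove).det
          * (M.submatrix Fin.castSucc Fin.castSucc).det
        - (M.submatrix (Fin.last m).castSucc.succAbove Fin.castSucc).det
          * (M.submatrix Fin.castSucc (Fin.last m).castSucc.succAbove).det := by
  have h := det_toBlocks₂₂_adjugate (M.submatrix finSumFinEquiv finSumFinEquiv)
  have e₀ : (finSumFinEquiv (Sum.inr 0 : Fin m ⊕ Fin 2)) = (Fin.last m).castSucc := rfl
  have e₁ : (finSumFinEquiv (Sum.inr 1 : Fin m ⊕ Fin 2)) = Fin.last (m + 1) := rfl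
  have hblock : (M.submatrix finSumFinEquiv finSumFinEquiv).toBlocks₁₁
      = M.submatrix (Fin.castAdd 2) (Fin.castAdd 2) := rfl
  rw [det_submatrix_equiv_self, hblock, adjugate_submatrix_equiv_self, det_fin_two] at h
  simp only [toBlocks₂₂, of_apply, submatrix_apply, e₀, e₁,
    adjugate_fin_succ_eq_det_submatrix, Fin.succAbove_last] at h
  rw [← h]
  have hs : ((-1 : R) ^ m) ^ 2 = 1 := by rw [← pow_mul, mul_comm, pow_mul]; simp
  simp only [Fin.val_last, Fin.val_castSucc, pow_add, pow_one]
  generalize (-1 : R) ^ m = s at hs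
  have hs4 : s ^ 4 = 1 := by linear_combination (s ^ 2 + 1) * hs
  ring_nf
  rw [hs4]
  ring

end Matrix

open Matrix in
theorem hasDerivAt_det_iteratedDeriv_add {f : ℂ → ℂ} (hf : Differentiable ℂ f) {n : ℕ}
    (r c : Fin n → ℕ) (z : ℂ) :
    HasDerivAt (fun w => (of fun j k => iteratedDeriv (r j + c k) f w).det)
      (∑ i, (of fun j k => iteratedDeriv (r j + Function.update c i (c i + 1) k) f z).det) z := by
  have hentry (p : ℕ) : HasDerivAt (iteratedDeriv p f) (iteratedDeriv (p + 1) f z) z := by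
    rw [iteratedDeriv_succ]
    exact ((hf.contDiff (n := ⊤)).differentiable_iteratedDeriv p
      (WithTop.coe_lt_top _)).differentiableAt.hasDerivAt
  simp only [det_apply', of_apply]
  rw [Finset.sum_comm]
  refine HasDerivAt.fun_sum fun σ _ => ?_
  rw [← Finset.mul_sum]
  refine HasDerivAt.const_mul _ ?_
  refine (HasDerivAt.fun_finsetProd fun i _ => hentry (r (σ i) + c i)).congr_deriv ?_
  refine Finset.sum_congr rfl fun i _ => ?_
  rw [← Finset.mul_prod_erase _ _ (Finset.mem_univ i), mul_comm, smul_eq_mul]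
  simp only [Function.update_self, ← add_assoc]
  congr 1
  refine Finset.prod_congr rfl fun j hj => ?_
  rw [Function.update_of_ne (Finset.ne_of_mem_erase hj)]

open Matrix in
/-- Differentiating a determinant of derivatives whose column shifts are consecutive affects only
the last column. -/
theorem hasDerivAt_det_iteratedDeriv_add_val {f : ℂ → ℂ} (hf : Differentiable ℂ f) {m : ℕ}
    (r : Fin (m + 1) → ℕ) (z : ℂ) :
    HasDerivAt (fun w => (of fun j k : Fin (m + 1) => iteratedDeriv (r j + k.castSucc.val) f w).det)
      (of fun j k => iteratedDeriv (r j + ((Fin.last m).castSucc.succAbove k).val) f z).det z := by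
  refine (hasDerivAt_det_iteratedDeriv_add hf r (fun k => k.castSucc.val) z).congr_deriv ?_
  rw [Fin.sum_univ_castSucc, Finset.sum_eq_zero, zero_add]
  · congr! with j k
    induction k using Fin.lastCases with
    | last => simp
    | cast k => simp [Fin.succAbove]
  · intro i _
    refine det_zero_of_column_eq (i := i.castSucc) (j := i.succ) (Fin.castSucc_lt_succ).ne
      fun j => ?_
    simp [Function.update_of_ne (Fin.castSucc_lt_succ (i := i)).ne']

/-- For an entire function `f`, the Hankel determinants of derivatives satisfy the Toda
equation with constant `1`:
`H_n H_n″ − (H_n′)² = H_{n+1} H_{n−1}`. -/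
theorem hankelDerivDet_toda (f : ℂ → ℂ) (hf : Differentiable ℂ f) (n : ℕ) (hn : 1 ≤ n)
    (z : ℂ) :
    hankelDerivDet f n z * deriv (deriv (hankelDerivDet f n)) z
        - (deriv (hankelDerivDet f n) z) ^ 2
      = hankelDerivDet f (n + 1) z * hankelDerivDet f (n - 1) z := by
  obtain ⟨m, rfl⟩ := Nat.exists_eq_add_of_le' hn
  let M (w : ℂ) : Matrix (Fin (m + 2)) (Fin (m + 2)) ℂ :=
    Matrix.of fun j k => iteratedDeriv (j.1 + k.1) f w
  have hsymm (w : ℂ) (a b : Fin (m + 1) → Fin (m + 2)) :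
      ((M w).submatrix a b).det = ((M w).submatrix b a).det := by
    rw [← Matrix.det_transpose]
    congr 1
    ext j k
    simp [M, add_comm]
  have hderiv (w : ℂ) (a : Fin (m + 1) → Fin (m + 2)) :
      HasDerivAt (fun w => ((M w).submatrix a Fin.castSucc).det)
        ((M w).submatrix a (Fin.last m).castSucc.succAbove).det w :=
    hasDerivAt_det_iteratedDeriv_add_val hf (fun j => (a j).val) w
  have h₁ : deriv (hankelDerivDet f (m + 1))
      = fun w => ((M w).submatrix (Fin.last m).castSucc.succAbove Fin.castSucc).det := by
    funext w
    rw [hsymm]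
    exact (hderiv w Fin.castSucc).deriv
  have h₂ : hankelDerivDet f (m + 1) z = ((M z).submatrix Fin.castSucc Fin.castSucc).det := rfl
  have h₃ : hankelDerivDet f (m + 1 - 1) z
      = ((M z).submatrix (Fin.castAdd 2) (Fin.castAdd 2)).det := rfl
  have h₄ : hankelDerivDet f (m + 1 + 1) z = (M z).det := rfl
  rw [h₁, (hderiv z _).deriv, h₂, h₃, h₄, Matrix.det_mul_det_submatrix_castAdd,
    hsymm z Fin.castSucc (Fin.last m).castSucc.succAbove]
  ring
end

section
/- Let α ∈ ℂ, z₀ ∈ ℂ, r > 0, and let σ : ℂ → ℂ be holomorphic on the punctured disk {z : 0 < |z − z₀| < r}, satisfying the Jimbo–Miwa–Okamoto σ-form (σ″(z))² + 4(σ′(z))³ + 2σ′(z)·(z·σ′(z) − σ(z)) = (α/2 + 1/4)² there, and suppose |σ(z)| → ∞ as z → z₀ (i.e., σ has a pole at z₀). Then the pole is simple with residue 1: (z − z₀)·σ(z) → 1 as z → z₀, z ≠ z₀. -/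
open Filter Topology

/-- If `f = (z - z₀)⁻ⁿ g` near `z₀` with `g` analytic, then
`f' = (z - z₀)⁻⁽ⁿ⁺¹⁾ ((z - z₀) g' - n g)` near `z₀`. -/
lemma eventually_deriv_mul_pow_eq {f g : ℂ → ℂ} {z₀ : ℂ} {n : ℕ} (hg : AnalyticAt ℂ g z₀)
    (h : ∀ᶠ z in 𝓝[≠] z₀, f z * (z - z₀) ^ n = g z) :
    ∀ᶠ z in 𝓝[≠] z₀, deriv f z * (z - z₀) ^ (n + 1) = (z - z₀) * deriv g z - n * g z := by
  have hf : f =ᶠ[𝓝[≠] z₀] fun z => g z / (z - z₀) ^ n := by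
    filter_upwards [h, self_mem_nhdsWithin] with z hz hne
    exact eq_div_of_mul_eq (pow_ne_zero _ (sub_ne_zero.2 hne)) hz
  filter_upwards [hf.nhdsNE_deriv, hg.eventually_analyticAt.filter_mono nhdsWithin_le_nhds,
    self_mem_nhdsWithin] with z hz hgz hne
  have hw : z - z₀ ≠ 0 := sub_ne_zero.2 hne
  have hd := hgz.differentiableAt.hasDerivAt.fun_div
    (((hasDerivAt_id' z).sub_const z₀).fun_pow n) (pow_ne_zero n hw)
  rw [hz, hd.deriv]
  rcases n with _ | n
  · simp [mul_comm]
  · simp only [Nat.add_sub_cancel]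
    field_simp
    ring

/-- A function that is holomorphic near `z₀` off `z₀` and tends to infinity at `z₀` has a pole
there: it is `(z - z₀)⁻ⁿ g` with `n ≥ 1` and `g` analytic and nonvanishing at `z₀`. -/
lemma exists_eventually_mul_pow_eq_of_tendsto_atTop {f : ℂ → ℂ} {z₀ : ℂ}
    (hf : ∀ᶠ z in 𝓝[≠] z₀, DifferentiableAt ℂ f z)
    (hpole : Tendsto (fun z => ‖f z‖) (𝓝[≠] z₀) atTop) :
    ∃ n : ℕ, n ≠ 0 ∧ ∃ g : ℂ → ℂ, AnalyticAt ℂ g z₀ ∧ g z₀ ≠ 0 ∧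
      ∀ᶠ z in 𝓝[≠] z₀, f z * (z - z₀) ^ n = g z := by
  have hne : ∀ᶠ z in 𝓝[≠] z₀, f z ≠ 0 := by
    filter_upwards [hpole.eventually_gt_atTop 0] with z hz
    exact norm_pos_iff.1 hz
  set u : ℂ → ℂ := Function.update (fun z => (f z)⁻¹) z₀ 0 with hu
  have hu0 : u z₀ = 0 := by simp [hu]
  have heq : ∀ z, z ≠ z₀ → u z = (f z)⁻¹ := fun z hz => by simp [hu, hz]
  have huan : AnalyticAt ℂ u z₀ := by
    apply Complex.analyticAt_of_differentiable_on_punctured_nhds_of_continuousAt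
    · filter_upwards [hf, hne, self_mem_nhdsWithin] with z hz hz0 hzz
      refine (hz.fun_inv hz0).congr_of_eventuallyEq ?_
      filter_upwards [isOpen_ne.mem_nhds hzz] with y hy using heq y hy
    · rw [hu, continuousAt_update_same]
      exact tendsto_inv₀_cobounded.comp (tendsto_norm_atTop_iff_cobounded.1 hpole)
  have hnz : ¬ ∀ᶠ z in 𝓝 z₀, u z = 0 := by
    intro h0
    obtain ⟨z, hz, hz0, hzz⟩ := ((h0.filter_mono nhdsWithin_le_nhds).and
      (hne.and (self_mem_nhdsWithin : {z₀}ᶜ ∈ 𝓝[≠] z₀))).exists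
    rw [heq z hzz] at hz
    exact inv_ne_zero hz0 hz
  obtain ⟨n, h, han, hh0, hh⟩ := huan.exists_eventuallyEq_pow_smul_nonzero_iff.2 hnz
  refine ⟨n, ?_, fun z => (h z)⁻¹, han.fun_inv hh0, inv_ne_zero hh0, ?_⟩
  · rintro rfl
    have := hh.self_of_nhds
    rw [hu0] at this
    simp at this
    exact hh0 this.symm
  · filter_upwards [hh.filter_mono nhdsWithin_le_nhds, self_mem_nhdsWithin, hne] with z hz hzz hz0
    rw [heq z hzz, smul_eq_mul] at hz
    have hw : z - z₀ ≠ 0 := sub_ne_zero.2 hzz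
    rw [← inv_inv (f z), hz, mul_inv, mul_comm, ← mul_assoc,
      mul_inv_cancel₀ (pow_ne_zero _ hw), one_mul]

/-- A solution of the Jimbo–Miwa–Okamoto σ-form of P_II which is holomorphic on a punctured
disk around `z₀` and blows up at `z₀` has a simple pole at `z₀` with residue `1`. -/
theorem sigma_form_pole_is_simple (α z₀ : ℂ) (r : ℝ) (hr : 0 < r) (σ : ℂ → ℂ)
    (hσ : DifferentiableOn ℂ σ (Metric.ball z₀ r \ {z₀}))
    (hS2 : ∀ z ∈ Metric.ball z₀ r \ {z₀},
      (deriv (deriv σ) z) ^ 2 + 4 * (deriv σ z) ^ 3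
        + 2 * deriv σ z * (z * deriv σ z - σ z) = (α / 2 + 1 / 4) ^ 2)
    (hpole : Filter.Tendsto (fun z => ‖σ z‖) (nhdsWithin z₀ {z₀}ᶜ) Filter.atTop) :
    Filter.Tendsto (fun z => (z - z₀) * σ z) (nhdsWithin z₀ {z₀}ᶜ) (nhds 1) := by
  have hball : Metric.ball z₀ r \ {z₀} ∈ 𝓝[≠] z₀ :=
    sdiff_mem_nhdsWithin_compl (Metric.ball_mem_nhds z₀ hr) _
  have hopen : IsOpen (Metric.ball z₀ r \ {z₀}) := Metric.isOpen_ball.sdiff isClosed_singleton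
  have hdiff : ∀ᶠ z in 𝓝[≠] z₀, DifferentiableAt ℂ σ z := by
    filter_upwards [hball] with z hz using hσ.differentiableAt (hopen.mem_nhds hz)
  obtain ⟨n, hn, G, hG, hG0, h0⟩ := exists_eventually_mul_pow_eq_of_tendsto_atTop hdiff hpole
  obtain ⟨m, rfl⟩ := Nat.exists_eq_succ_of_ne_zero hn
  simp only [Nat.succ_eq_add_one] at h0
  have h1 := eventually_deriv_mul_pow_eq hG h0
  set A : ℂ → ℂ := fun z => (z - z₀) * deriv G z - ((m + 1 : ℕ) : ℂ) * G z with hA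
  have hAan : AnalyticAt ℂ A z₀ := by
    have := hG.deriv
    fun_prop
  have h2 := eventually_deriv_mul_pow_eq hAan h1
  set B : ℂ → ℂ := fun z => (z - z₀) * deriv A z - ((m + 1 + 1 : ℕ) : ℂ) * A z with hB
  have hBan : AnalyticAt ℂ B z₀ := by
    have := hAan.deriv
    fun_prop
  have key : ∀ᶠ z in 𝓝[≠] z₀, (z - z₀) ^ m * B z ^ 2 + 4 * A z ^ 3
      + 2 * A z * (z - z₀) ^ (m + 2) * (z * A z - (z - z₀) * G z)
      = (α / 2 + 1 / 4) ^ 2 * (z - z₀) ^ (3 * m + 6) := by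
    filter_upwards [hball, h0, h1, h2] with z hz e0 e1 e2
    change _ = A z at e1
    change _ = B z at e2
    rw [← hS2 z hz, ← e2, ← e1, ← e0]
    ring
  have hlim : (z₀ - z₀) ^ m * B z₀ ^ 2 + 4 * A z₀ ^ 3
      + 2 * A z₀ * (z₀ - z₀) ^ (m + 2) * (z₀ * A z₀ - (z₀ - z₀) * G z₀)
      = (α / 2 + 1 / 4) ^ 2 * (z₀ - z₀) ^ (3 * m + 6) := by
    have cA := hAan.continuousAt
    have cB := hBan.continuousAt
    have cG := hG.continuousAt
    refine tendsto_nhds_unique_of_eventuallyEq (l := 𝓝[≠] z₀) ?_ ?_ key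
    · exact ContinuousAt.continuousWithinAt (by fun_prop)
    · exact ContinuousAt.continuousWithinAt (by fun_prop)
  have hA0 : A z₀ = -((m : ℂ) + 1) * G z₀ := by simp [hA]; ring
  have hB0 : B z₀ = ((m : ℂ) + 2) * (((m : ℂ) + 1) * G z₀) := by simp [hB, hA0]; ring
  have hm1 : (m : ℂ) + 1 ≠ 0 := Nat.cast_add_one_ne_zero m
  obtain rfl : m = 0 := by
    by_contra hm
    simp [hm, hA0, hG0] at hlim
    exact hm1 (by linear_combination -hlim)
  have hG1 : G z₀ = 1 := by
    simp [hA0, hB0] at hlim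
    have : G z₀ ^ 2 * (G z₀ - 1) = 0 := by linear_combination -hlim / 4
    exact sub_eq_zero.1 ((mul_eq_zero.1 this).resolve_left (pow_ne_zero 2 hG0))
  rw [← hG1]
  refine (hG.continuousAt.tendsto.mono_left nhdsWithin_le_nhds).congr' ?_
  filter_upwards [h0] with z hz
  rw [← hz]
  ring
end

section
/- Let α ∈ ℂ, z₀ ∈ ℂ, r > 0, and let g : ℂ → ℂ be holomorphic on the disk {z : |z − z₀| < r}. Suppose that the function σ(z) := 1/(z − z₀) + g(z) satisfies the Jimbo–Miwa–Okamoto σ-form (σ″(z))² + 4(σ′(z))³ + 2σ′(z)·(z·σ′(z) − σ(z)) = (α/2 + 1/4)² on the punctured disk {z : 0 < |z − z₀| < r}. Then the first two Taylor coefficients of g after the constant term are determined: g′(z₀) = −z₀/6 and g″(z₀) = −1/4; equivalently, σ(z) = 1/(z − z₀) + s₀ − (z₀/6)(z − z₀) − (1/8)(z − z₀)² + O((z − z₀)³) for some s₀ ∈ ℂ. -/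
/-- Local expansion at a pole of a solution of the Jimbo–Miwa–Okamoto σ-form of P_II: if
`σ(z) = 1/(z − z₀) + g(z)` with `g` holomorphic on the disk `{|z − z₀| < r}` satisfies the
σ-form on the punctured disk, then `g′(z₀) = −z₀/6` and `g″(z₀) = −1/4`, i.e.
`σ(z) = 1/(z − z₀) + s₀ − (z₀/6)(z − z₀) − (1/8)(z − z₀)² + ⋯`. -/
theorem sigma_form_pole_expansion (α z₀ : ℂ) (r : ℝ) (hr : 0 < r) (g : ℂ → ℂ)
    (hg : DifferentiableOn ℂ g (Metric.ball z₀ r))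
    (σ : ℂ → ℂ) (hσ : ∀ z, σ z = 1 / (z - z₀) + g z)
    (hS2 : ∀ z ∈ Metric.ball z₀ r \ {z₀},
      (deriv (deriv σ) z) ^ 2 + 4 * (deriv σ z) ^ 3
        + 2 * deriv σ z * (z * deriv σ z - σ z) = (α / 2 + 1 / 4) ^ 2) :
    deriv g z₀ = -z₀ / 6 ∧ deriv (deriv g) z₀ = -1 / 4 := by
  set B := Metric.ball z₀ r with hB
  have hBo : IsOpen B := Metric.isOpen_ball
  have hz₀ : z₀ ∈ B := Metric.mem_ball_self hr
  have hg' : DifferentiableOn ℂ (deriv g) B := hg.deriv hBo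
  have hg'' : DifferentiableOn ℂ (deriv (deriv g)) B := hg'.deriv hBo
  have hσ' : ∀ z ∈ B \ {z₀}, deriv σ z = -1 / (z - z₀) ^ 2 + deriv g z := by
    intro z hz
    have hne : z - z₀ ≠ 0 := sub_ne_zero.mpr hz.2
    have h₁ := (hg.differentiableAt (hBo.mem_nhds hz.1)).hasDerivAt
    have h₂ := ((hasDerivAt_id z).sub_const z₀).inv hne
    have h₃ := (h₂.add h₁).deriv
    have hfun : σ = (fun x => id x - z₀)⁻¹ + g := by
      funext x
      simp [hσ]
    rw [hfun, h₃]
    simp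
  have hσ'' : ∀ z ∈ B \ {z₀}, deriv (deriv σ) z = 2 / (z - z₀) ^ 3 + deriv (deriv g) z := by
    intro z hz
    have hne : z - z₀ ≠ 0 := sub_ne_zero.mpr hz.2
    have h₁ := (hg'.differentiableAt (hBo.mem_nhds hz.1)).hasDerivAt
    have h₂ := (((hasDerivAt_id z).sub_const z₀).pow 2).inv (pow_ne_zero 2 hne)
    have h₃ := h₂.neg.add h₁
    have hopen : IsOpen (B \ {z₀}) := hBo.sdiff isClosed_singleton
    have heq : deriv σ =ᶠ[nhds z] -((fun x => id x - z₀) ^ 2)⁻¹ + deriv g := by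
      filter_upwards [hopen.mem_nhds hz] with x hx
      rw [hσ' x hx]
      simp [div_eq_mul_inv]
    rw [heq.deriv_eq, h₃.deriv]
    simp only [id]
    field_simp
    norm_num
    ring
  -- Clearing denominators, the equation reads `p + (z - z₀) ^ 2 * R = 0`.
  let R : ℂ → ℂ := fun z =>
    (z - z₀) ^ 2 * deriv (deriv g) z ^ 2 - 12 * deriv g z ^ 2
      + 4 * (z - z₀) ^ 2 * deriv g z ^ 3 - 2 * (z * deriv g z - g z)
      + 2 * deriv g z * (-z₀ - 2 * (z - z₀) + (z - z₀) ^ 2 * (z * deriv g z - g z))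
      - (α / 2 + 1 / 4) ^ 2 * (z - z₀) ^ 2
  let F : ℂ → ℂ := fun z =>
    4 * (z - z₀) * deriv (deriv g) z + 12 * deriv g z + 2 * z₀ + 4 * (z - z₀)
      + (z - z₀) ^ 2 * R z
  have hd := hg.differentiableAt (hBo.mem_nhds hz₀)
  have hd' := hg'.differentiableAt (hBo.mem_nhds hz₀)
  have hd'' := hg''.differentiableAt (hBo.mem_nhds hz₀)
  have hR : DifferentiableAt ℂ R z₀ := by fun_prop
  have hw : HasDerivAt (fun z : ℂ => z - z₀) 1 z₀ := (hasDerivAt_id z₀).sub_const z₀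
  have hF : HasDerivAt F (16 * deriv (deriv g) z₀ + 4) z₀ := by
    have h := (((((hw.const_mul 4).mul hd''.hasDerivAt).add
      (hd'.hasDerivAt.const_mul 12)).add_const (2 * z₀)).add (hw.const_mul 4)).add
      ((hw.pow 2).mul hR.hasDerivAt)
    refine h.congr_deriv ?_
    simp
    ring
  have hFpunct : ∀ z ∈ B \ {z₀}, F z = 0 := by
    intro z hz
    have hne : z - z₀ ≠ 0 := sub_ne_zero.mpr hz.2
    have h := hS2 z hz
    rw [hσ'' z hz, hσ' z hz, hσ z] at h
    have key : F z = (z - z₀) ^ 4 * ((2 / (z - z₀) ^ 3 + deriv (deriv g) z) ^ 2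
        + 4 * (-1 / (z - z₀) ^ 2 + deriv g z) ^ 3
        + 2 * (-1 / (z - z₀) ^ 2 + deriv g z) * (z * (-1 / (z - z₀) ^ 2 + deriv g z)
          - (1 / (z - z₀) + g z)) - (α / 2 + 1 / 4) ^ 2) := by
      simp only [F, R]
      field_simp
      ring
    rw [key, h, sub_self, mul_zero]
  have hFev : F =ᶠ[nhdsWithin z₀ {z₀}ᶜ] fun _ => 0 := by
    filter_upwards [mem_nhdsWithin_of_mem_nhds (hBo.mem_nhds hz₀), self_mem_nhdsWithin]
      with z hz hz'
    exact hFpunct z ⟨hz, hz'⟩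
  have hF0 : F z₀ = 0 :=
    tendsto_nhds_unique (hF.continuousAt.tendsto.mono_left nhdsWithin_le_nhds)
      (tendsto_const_nhds.congr' hFev.symm)
  have hFnhds : F =ᶠ[nhds z₀] fun _ => 0 := by
    filter_upwards [hBo.mem_nhds hz₀] with z hz
    by_cases h : z = z₀
    · rw [h, hF0]
    · exact hFpunct z ⟨hz, h⟩
  have hF' : 16 * deriv (deriv g) z₀ + 4 = 0 := by
    rw [← hF.deriv, hFnhds.deriv_eq, deriv_const]
  have hF0' : 12 * deriv g z₀ + 2 * z₀ = 0 := by simpa [F] using hF0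
  exact ⟨by linear_combination hF0' / 12, by linear_combination hF' / 16⟩
end

section
/- Let t, x ∈ ℂ with x ≠ 0 and x³ − t·x − 1 = 0, and let s ∈ ℂ satisfy s² = 2/x. Set a := x − i·s, b := x + i·s, c := −x, and K := x − 1/(4x²). Then the polynomial identity (1/4)·(z − a)·(z − b)·(z − c)² = (1/4)·(z² − t)² + z + K holds for all z ∈ ℂ. -/
/-- One-cut factorization of the quartic `Q(z;t) = (1/4)(z² − t)² + z + K`: if `x ≠ 0`
solves `x³ − tx − 1 = 0` and `s² = 2/x`, then with `a = x − i s`, `b = x + i s`, `c = −x`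
and `K = x − 1/(4x²)` one has `(1/4)(z − a)(z − b)(z − c)² = (1/4)(z² − t)² + z + K`. -/
theorem one_cut_quartic_factorization (t x s : ℂ) (hx : x ≠ 0)
    (hcubic : x ^ 3 - t * x - 1 = 0) (hs : s ^ 2 = 2 / x) :
    ∀ z : ℂ,
      (1 / 4) * (z - (x - Complex.I * s)) * (z - (x + Complex.I * s)) * (z - (-x)) ^ 2
        = (1 / 4) * (z ^ 2 - t) ^ 2 + z + (x - 1 / (4 * x ^ 2)) := by
  intro z
  have ht : t = x ^ 2 - 1 / x := by
    field_simp
    linear_combination -hcubic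
  have hquad : (z - (x - Complex.I * s)) * (z - (x + Complex.I * s))
      = (z - x) ^ 2 + 2 / x := by
    linear_combination hs - s ^ 2 * Complex.I_sq
  rw [mul_assoc (1 / 4), hquad, ht]
  field_simp
  ring
end
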